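/- arXiv:2510.20840 — 5 statements merged into one kernel-verified Lean document; each statement's English description precedes it below -/
import Mathlib

section
/- Let p1, p2 ∈ [0,1] and define the a-posterior probabilities P1 = p1·(1 - p2/2) and P2 = p2·(1 - p1/2). Then p1 = 1 + (P1 - P2)/2 - √(1 - (P1 + P2) + (P1 - P2)²/4). -/
/-- For a-prior probabilities `p1, p2 ∈ [0,1]` with a-posterior probabilities
`P1 = p1·(1 - p2/2)` and `P2 = p2·(1 - p1/2)`, we have
`p1 = 1 + (P1 - P2)/2 - √(1 - (P1 + P2) + (P1 - P2)²/4)`. -/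
theorem stmt_0 (p1 p2 : ℝ) (hp1 : p1 ∈ Set.Icc (0:ℝ) 1) (hp2 : p2 ∈ Set.Icc (0:ℝ) 1)
    (P1 P2 : ℝ) (hP1 : P1 = p1 * (1 - p2 / 2)) (hP2 : P2 = p2 * (1 - p1 / 2)) :
    p1 = 1 + (P1 - P2) / 2 - Real.sqrt (1 - (P1 + P2) + (P1 - P2) ^ 2 / 4) := by
  have h : 1 - (P1 + P2) + (P1 - P2) ^ 2 / 4 = (1 - (p1 + p2) / 2) ^ 2 := by
    subst hP1 hP2
    ring
  rw [h, Real.sqrt_sq (by linarith [hp1.2, hp2.2]), hP1, hP2]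
  ring
end

section
/- Let p1, p2 ∈ [0,1] and define the a-posterior probabilities P1 = p1·(1 - p2/2) and P2 = p2·(1 - p1/2). Then p2 = 1 + (P2 - P1)/2 - √(1 - (P1 + P2) + (P1 - P2)²/4). -/
/-- For a-prior probabilities `p1, p2 ∈ [0,1]` with a-posterior probabilities
`P1 = p1·(1 - p2/2)` and `P2 = p2·(1 - p1/2)`, we have
`p2 = 1 + (P2 - P1)/2 - √(1 - (P1 + P2) + (P1 - P2)²/4)`. -/
theorem stmt_1 (p1 p2 : ℝ) (hp1 : p1 ∈ Set.Icc (0:ℝ) 1) (hp2 : p2 ∈ Set.Icc (0:ℝ) 1)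
    (P1 P2 : ℝ) (hP1 : P1 = p1 * (1 - p2 / 2)) (hP2 : P2 = p2 * (1 - p1 / 2)) :
    p2 = 1 + (P2 - P1) / 2 - Real.sqrt (1 - (P1 + P2) + (P1 - P2) ^ 2 / 4) := by
  obtain ⟨_, h1⟩ := hp1
  obtain ⟨_, h2⟩ := hp2
  have h : 1 - (P1 + P2) + (P1 - P2) ^ 2 / 4 = (1 - (p1 + p2) / 2) ^ 2 := by
    rw [hP1, hP2]; ring
  rw [h, Real.sqrt_sq (by linarith), hP1, hP2]
  ring
end

section
/- For all d, e ∈ [0,1], Ψ1(d·(1 - e/2), e·(1 - d/2)) = d and Ψ2(d·(1 - e/2), e·(1 - d/2)) = e. That is, the transformation Ψ of Theorem 1 recovers the a-prior death and emigration probabilities from the a-posterior ones. -/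
/-- First component of the a-posterior-to-a-prior transformation `Ψ`. -/
noncomputable def Psi1 (D E : ℝ) : ℝ :=
  1 + (D - E) / 2 - Real.sqrt (1 - (D + E) + (D - E) ^ 2 / 4)

/-- Second component of the a-posterior-to-a-prior transformation `Ψ`. -/
noncomputable def Psi2 (D E : ℝ) : ℝ :=
  1 + (E - D) / 2 - Real.sqrt (1 - (D + E) + (D - E) ^ 2 / 4)

/-- For all `d, e ∈ [0,1]`, the transformation `Ψ` recovers the a-prior death and
emigration probabilities from the a-posterior ones:
`Ψ1(d·(1 - e/2), e·(1 - d/2)) = d` and `Ψ2(d·(1 - e/2), e·(1 - d/2)) = e`. -/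
theorem stmt_9 (d e : ℝ) (hd : d ∈ Set.Icc (0:ℝ) 1) (he : e ∈ Set.Icc (0:ℝ) 1) :
    Psi1 (d * (1 - e / 2)) (e * (1 - d / 2)) = d ∧
      Psi2 (d * (1 - e / 2)) (e * (1 - d / 2)) = e := by
  obtain ⟨hd0, hd1⟩ := hd
  obtain ⟨he0, he1⟩ := he
  have key : Real.sqrt (1 - (d * (1 - e / 2) + e * (1 - d / 2)) +
      (d * (1 - e / 2) - e * (1 - d / 2)) ^ 2 / 4) = 1 - (d + e) / 2 := by
    rw [show 1 - (d * (1 - e / 2) + e * (1 - d / 2)) +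
      (d * (1 - e / 2) - e * (1 - d / 2)) ^ 2 / 4 = (1 - (d + e) / 2) ^ 2 by ring]
    exact Real.sqrt_sq (by linarith)
  unfold Psi1 Psi2
  rw [key]
  constructor <;> ring
end

section
/- Let D, E ≥ 0 with D + E ≤ 1. Then Ψ1(D, E) ∈ [0,1] and Ψ2(D, E) ∈ [0,1], i.e. the transformed a-prior values are valid probabilities. -/
/-- For `D, E ≥ 0` with `D + E ≤ 1`, the transformed a-prior values `Ψ1(D,E)` and
`Ψ2(D,E)` are valid probabilities, i.e. lie in `[0,1]`. -/
theorem stmt_10 (D E : ℝ) (hD : 0 ≤ D) (hE : 0 ≤ E) (hsum : D + E ≤ 1) :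
    Psi1 D E ∈ Set.Icc (0:ℝ) 1 ∧ Psi2 D E ∈ Set.Icc (0:ℝ) 1 := by
  have h1 : Real.sqrt (1 - (D + E) + (D - E) ^ 2 / 4) ≤ 1 + (D - E) / 2 :=
    Real.sqrt_le_iff.mpr ⟨by linarith, by nlinarith⟩
  have h2 : Real.sqrt (1 - (D + E) + (D - E) ^ 2 / 4) ≤ 1 + (E - D) / 2 :=
    Real.sqrt_le_iff.mpr ⟨by linarith, by nlinarith⟩
  have h3 : (D - E) / 2 ≤ Real.sqrt (1 - (D + E) + (D - E) ^ 2 / 4) :=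
    Real.le_sqrt_of_sq_le (by nlinarith)
  have h4 : (E - D) / 2 ≤ Real.sqrt (1 - (D + E) + (D - E) ^ 2 / 4) :=
    Real.le_sqrt_of_sq_le (by nlinarith)
  unfold Psi1 Psi2
  exact ⟨⟨by linarith, by linarith⟩, ⟨by linarith, by linarith⟩⟩
end

section
/- The map (p1, p2) ↦ (p1·(1 - p2/2), p2·(1 - p1/2)) is injective on [0,1] × [0,1]: if p1·(1 - p2/2) = q1·(1 - q2/2) and p2·(1 - p1/2) = q2·(1 - q1/2) for p1, p2, q1, q2 ∈ [0,1], then p1 = q1 and p2 = q2. -/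
/-- The map `(p1, p2) ↦ (p1·(1 - p2/2), p2·(1 - p1/2))` is injective on `[0,1] × [0,1]`. -/
theorem stmt_18 (p1 p2 q1 q2 : ℝ)
    (hp1 : p1 ∈ Set.Icc (0:ℝ) 1) (hp2 : p2 ∈ Set.Icc (0:ℝ) 1)
    (hq1 : q1 ∈ Set.Icc (0:ℝ) 1) (hq2 : q2 ∈ Set.Icc (0:ℝ) 1)
    (h1 : p1 * (1 - p2 / 2) = q1 * (1 - q2 / 2))
    (h2 : p2 * (1 - p1 / 2) = q2 * (1 - q1 / 2)) :
    p1 = q1 ∧ p2 = q2 := by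
  obtain ⟨a1, a2⟩ := hp1
  obtain ⟨b1, b2⟩ := hp2
  obtain ⟨c1, c2⟩ := hq1
  obtain ⟨d1, d2⟩ := hq2
  have hd : q2 = p2 + (q1 - p1) := by linarith
  have hm : (q1 - p1) * (2 - p2 - q1) = 0 := by
    subst hd
    linarith
  rcases mul_eq_zero.mp hm with h | h
  · constructor <;> linarith
  · constructor <;> linarith
end
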